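/- Let 𝒜 be an abelian category with enough projective objects and let 0 → N → E → M → 0 be a short exact sequence in 𝒜 such that E is both projective and injective. Then qpd_𝒜(M) ≤ qpd_𝒜(N) + 1. -/

import Mathlib

/-!
Quasi-projective dimension, following Gheibi–Jorgensen–Takahashi and
Chen–Chen–Liu, "Properties of quasi-projective dimension over abelian categories".
-/

open CategoryTheory CategoryTheory.Limits

attribute [local instance] CategoryTheory.Abelian.hasFiniteBiproducts

noncomputable section

universe v u

namespace QPD

variable {A : Type*} [Category A] [Abelian A]

/-- The direct sum of `n` copies of `M`. -/
def copies (M : A) (n : ℕ) : A := ⨁ (fun _ : Fin n => M)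

/-- `X` belongs to `add M`: it is a direct summand of a finite direct sum of copies of `M`. -/
def inAdd (M X : A) : Prop :=
  ∃ (n : ℕ) (s : X ⟶ copies M n) (r : copies M n ⟶ X), s ≫ r = 𝟙 X

/-- `P` is a quasi-projective resolution of `M`: a bounded-below complex of projective
objects whose `j`-th homology is a direct sum of `mult j` copies of `M`, where the
multiplicities `mult j` are not all zero. -/
structure IsQuasiProjRes (M : A) (P : ChainComplex A ℤ) : Prop where
  projective : ∀ i, Projective (P.X i)
  bddBelow : ∃ a : ℤ, ∀ i, i < a → IsZero (P.X i)
  homology_iso : ∃ mult : ℤ → ℕ, (∃ j, mult j ≠ 0) ∧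
    ∀ j, Nonempty (P.homology j ≅ copies M (mult j))

/-- `P` is a finite (i.e. bounded) quasi-projective resolution of `M`. -/
structure IsFiniteQuasiProjRes (M : A) (P : ChainComplex A ℤ) extends
    IsQuasiProjRes M P : Prop where
  bddAbove : ∃ b : ℤ, ∀ i, b < i → IsZero (P.X i)

/-- `s` is the supremum of the degrees in which `P` is nonzero. -/
def IsSup (P : ChainComplex A ℤ) (s : ℤ) : Prop :=
  ¬ IsZero (P.X s) ∧ ∀ i, s < i → IsZero (P.X i)

/-- `t` is the supremum of the degrees in which the homology of `P` is nonzero. -/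
def IsHSup (P : ChainComplex A ℤ) (t : ℤ) : Prop :=
  ¬ IsZero (P.homology t) ∧ ∀ i, t < i → IsZero (P.homology i)

/-- `t` is the infimum of the degrees in which the homology of `P` is nonzero. -/
def IsHInf (P : ChainComplex A ℤ) (t : ℤ) : Prop :=
  ¬ IsZero (P.homology t) ∧ ∀ i, i < t → IsZero (P.homology i)

open Classical in
/-- The quasi-projective dimension of `M`, as an element of `ℕ∞`: the infimum of
`sup P• - hsup P•` over all finite quasi-projective resolutions `P•` of `M`
(it is `0` for the zero object and `⊤` if no finite quasi-projective resolution exists). -/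
def qpd (M : A) : ℕ∞ :=
  if IsZero M then 0
  else sInf {d : ℕ∞ | ∃ (P : ChainComplex A ℤ) (s t : ℤ),
    IsFiniteQuasiProjRes M P ∧ IsSup P s ∧ IsHSup P t ∧ d = ((s - t).toNat : ℕ∞)}

/-- `M` admits a projective resolution of length at most `n`. -/
def pdLE (M : A) (n : ℕ) : Prop :=
  ∃ P : ChainComplex A ℤ, (∀ i, Projective (P.X i)) ∧
    (∀ i : ℤ, i < 0 → IsZero (P.X i)) ∧ (∀ i : ℤ, (n : ℤ) < i → IsZero (P.X i)) ∧
    (∀ i : ℤ, i ≠ 0 → IsZero (P.homology i)) ∧ Nonempty (P.homology 0 ≅ M)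

/-- The projective dimension of `M`, as an element of `ℕ∞`. -/
def pd (M : A) : ℕ∞ := sInf {d : ℕ∞ | ∃ n : ℕ, d = (n : ℕ∞) ∧ pdLE M n}

open Classical in
/-- Quasi-projective dimension computed using only complexes all of whose terms satisfy the
predicate `Q` (e.g. `Q` = "finitely generated", for the category of finitely presented
modules over a left coherent ring). -/
def qpdRel (Q : A → Prop) (M : A) : ℕ∞ :=
  if IsZero M then 0
  else sInf {d : ℕ∞ | ∃ (P : ChainComplex A ℤ) (s t : ℤ),
    IsFiniteQuasiProjRes M P ∧ (∀ i, Q (P.X i)) ∧ IsSup P s ∧ IsHSup P t ∧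
    d = ((s - t).toNat : ℕ∞)}

/-- Projective dimension computed using only resolutions all of whose terms satisfy the
predicate `Q`. -/
def pdRel (Q : A → Prop) (M : A) : ℕ∞ :=
  sInf {d : ℕ∞ | ∃ n : ℕ, d = (n : ℕ∞) ∧ ∃ P : ChainComplex A ℤ,
    (∀ i, Projective (P.X i)) ∧ (∀ i, Q (P.X i)) ∧
    (∀ i : ℤ, i < 0 → IsZero (P.X i)) ∧ (∀ i : ℤ, (n : ℤ) < i → IsZero (P.X i)) ∧
    (∀ i : ℤ, i ≠ 0 → IsZero (P.homology i)) ∧ Nonempty (P.homology 0 ≅ M)}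

/-- Vanishing of the `n`-th Ext group, `Ext_𝒜^n(M, N) = 0`. -/
def extIsZero [EnoughProjectives A] (M N : A) (n : ℕ) : Prop :=
  IsZero (((_root_.Ext ℤ A n).obj (Opposite.op M)).obj N)

/-- The quasi-projective dimension of a finitely presented module over a (left coherent)
ring, computed inside the abelian category of finitely presented modules, i.e. via bounded
complexes of finitely generated projective modules. -/
def qpdFG {R : Type u} [Ring R] (M : ModuleCat.{u} R) : ℕ∞ :=
  qpdRel (fun N : ModuleCat.{u} R => Module.Finite R N) M

/-- The projective dimension of a finitely presented module over a (left coherent) ring,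
computed inside the abelian category of finitely presented modules. -/
def pdFG {R : Type u} [Ring R] (M : ModuleCat.{u} R) : ℕ∞ :=
  pdRel (fun N : ModuleCat.{u} R => Module.Finite R N) M

/-- A ring is left coherent if every finitely generated left ideal is finitely presented. -/
def IsLeftCoherent (R : Type u) [Ring R] : Prop :=
  ∀ I : Ideal R, I.FG → Module.FinitePresentation R I

/-- The quasi-global dimension of a ring: the supremum of the quasi-projective dimensions
of all finitely generated left modules. -/
def qgldim (R : Type u) [Ring R] : ℕ∞ :=
  sSup {d : ℕ∞ | ∃ M : ModuleCat.{u} R, Module.Finite R M ∧ d = qpd M}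

/-- The global dimension of a ring: the supremum of the projective dimensions of all
finitely generated left modules. -/
def gldim (R : Type u) [Ring R] : ℕ∞ :=
  sSup {d : ℕ∞ | ∃ M : ModuleCat.{u} R, Module.Finite R M ∧ d = pd M}

/-- The finitistic dimension of a ring: the supremum of the projective dimensions of all
finitely generated left modules of finite projective dimension. -/
def findim (R : Type u) [Ring R] : ℕ∞ :=
  sSup {d : ℕ∞ | ∃ M : ModuleCat.{u} R, Module.Finite R M ∧ d = pd M ∧ pd M ≠ ⊤}

/-- The depth of a module over a Noetherian local ring:
`depth M = inf {i : Ext^i(R/𝔪, M) ≠ 0}`. -/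
def depth {R : Type u} [CommRing R] [IsLocalRing R] (M : ModuleCat.{u} R) : ℕ∞ :=
  sInf {d : ℕ∞ | ∃ n : ℕ, d = (n : ℕ∞) ∧
    ¬ IsZero (((_root_.Ext ℤ (ModuleCat.{u} R) n).obj
      (Opposite.op (ModuleCat.of R (IsLocalRing.ResidueField R)))).obj M)}

end QPD

end

section

open HomologicalComplex

namespace QPD

variable {A : Type*} [Category A] [Abelian A]

/-- The mapping cone of an identity morphism has vanishing homology. -/
lemma isZero_homology_homotopyCofiber_id (P : ChainComplex A ℤ) (i : ℤ) :
    IsZero ((homotopyCofiber (𝟙 P)).homology i) := by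
  let h : ∀ a b : ℤ, (ComplexShape.down ℤ).Rel b a →
      ((homotopyCofiber (𝟙 P)).X a ⟶ (homotopyCofiber (𝟙 P)).X b) := fun a b hab =>
    homotopyCofiber.sndX (𝟙 P) a ≫ homotopyCofiber.inlX (𝟙 P) a b hab
  have hid : Homotopy.nullHomotopicMap' h = 𝟙 (homotopyCofiber (𝟙 P)) := by
    ext j
    have h₁ : (ComplexShape.down ℤ).Rel (j + 1) j := by simp
    have h₂ : (ComplexShape.down ℤ).Rel j (j - 1) := by simp
    rw [Homotopy.nullHomotopicMap'_f h₁ h₂]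
    apply homotopyCofiber.ext_from_X (𝟙 P) (j - 1) j h₂
    · simp [h, homotopyCofiber.inlX_d_assoc (𝟙 P) j (j - 1) (j - 1 - 1) h₂ (by simp)]
    · simp [h, homotopyCofiber.inlX_d (𝟙 P) (j + 1) j (j - 1) h₁ h₂]
  have e := (Homotopy.nullHomotopy' h).homologyMap_eq i
  rw [hid, homologyMap_id, homologyMap_zero] at e
  rwa [IsZero.iff_id_eq_zero]

/-- The complex with given terms and zero differentials. -/
def zeroDifferential (E : ℤ → A) : ChainComplex A ℤ where
  X := E
  d _ _ := 0

/-- The homology objects of a complex with zero differentials are its terms. -/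
noncomputable def homologyIsoX (J : ChainComplex A ℤ) (hJ : ∀ i j, J.d i j = 0) (j : ℤ) :
    J.homology j ≅ J.X j :=
  J.isoHomologyι j _ rfl (hJ _ _) ≪≫ (J.pOpcyclesIso _ j rfl (hJ _ _)).symm

/-- Morphisms from the homology objects of `P` to the terms of a complex `J` of injective
objects with zero differentials are induced by a morphism of complexes. -/
lemma exists_hom_homologyMap_eq (P J : ChainComplex A ℤ) (hJ : ∀ i j, J.d i j = 0)
    (hinj : ∀ j, Injective (J.X j)) (m : ∀ j, P.homology j ⟶ J.X j) :
    ∃ f : P ⟶ J, ∀ j, homologyMap f j ≫ (homologyIsoX J hJ j).hom = m j := by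
  let g : ∀ j, P.opcycles j ⟶ J.X j := fun j => Injective.factorThru (m j) (P.homologyι j)
  have hg : ∀ j, P.homologyι j ≫ g j = m j := fun j => Injective.comp_factorThru _ _
  let f : P ⟶ J :=
    { f := fun j => P.pOpcycles j ≫ g j
      comm' := fun i j _ => by simp [hJ] }
  refine ⟨f, fun j => ?_⟩
  have hfg : opcyclesMap f j = g j ≫ J.pOpcycles j := by
    rw [← cancel_epi (P.pOpcycles j), p_opcyclesMap]
    simp [f]
  simp [homologyIsoX, hfg, ← hg]

/-- If `K` has vanishing homology, the first projection `J ⊞ K ⟶ J` induces isomorphisms in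
homology. -/
lemma isIso_homologyMap_biprod_fst (J K : ChainComplex A ℤ) (j : ℤ)
    (hK : IsZero (K.homology j)) :
    IsIso (homologyMap (biprod.fst : J ⊞ K ⟶ J) j) := by
  refine ⟨homologyMap biprod.inl j, ?_, ?_⟩
  · have e : (biprod.fst : J ⊞ K ⟶ J) ≫ biprod.inl + biprod.snd ≫ biprod.inr = 𝟙 _ :=
      biprod.total
    rw [← homologyMap_id, ← e, homologyMap_add, homologyMap_comp, homologyMap_comp,
      hK.eq_of_tgt (homologyMap biprod.snd j) 0, zero_comp, add_zero]
  · rw [← homologyMap_comp, biprod.inl_fst, homologyMap_id]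

/-- If the first morphism of a short exact sequence of complexes is injective in homology,
then the homology of the third complex is the cokernel. -/
lemma shortExact_homology (S : ShortComplex (ChainComplex A ℤ)) (hS : S.ShortExact)
    (hf : ∀ j, Mono (homologyMap S.f j)) (j : ℤ) :
    (S.map (homologyFunctor A (ComplexShape.down ℤ) j)).ShortExact := by
  have hδ : hS.δ j (j - 1) (by simp) = 0 := by
    have := hf (j - 1)
    rw [← cancel_mono (homologyMap S.f (j - 1)), hS.δ_comp, zero_comp]
  exact { exact := hS.homology_exact₂ j
          mono_f := hf j
          epi_g := (hS.homology_exact₃ j (j - 1) (by simp)).epi_f hδ }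

/-- Given a complex `P` of projectives and short exact sequences starting with the homology
objects of `P` whose middle terms are both projective and injective, there is a complex of
projectives whose homology objects are the last terms of these sequences. -/
lemma exists_complex_homology_iso (P : ChainComplex A ℤ) (hP : ∀ j, Projective (P.X j))
    (T : ℤ → ShortComplex A) (hT : ∀ j, (T j).ShortExact) (e : ∀ j, P.homology j ≅ (T j).X₁)
    (hproj : ∀ j, Projective (T j).X₂) (hinj : ∀ j, Injective (T j).X₂) :
    ∃ Q : ChainComplex A ℤ, (∀ j, Projective (Q.X j)) ∧
      (∀ j, Nonempty (Q.homology j ≅ (T j).X₃)) ∧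
      ∀ j, IsZero (P.X j) → IsZero (P.X (j - 1)) → IsZero (T j).X₂ → IsZero (Q.X j) := by
  have hmono : ∀ j, Mono (T j).f := fun j => (hT j).mono_f
  have hepi : ∀ j, Epi (T j).g := fun j => (hT j).epi_g
  let D := homotopyCofiber (𝟙 P)
  let I := zeroDifferential fun j => (T j).X₂
  have hI : ∀ i j, I.d i j = 0 := fun _ _ => rfl
  let m : ∀ j, P.homology j ⟶ I.X j := fun j => (e j).hom ≫ (T j).f
  have hm : ∀ j, Mono (m j) := fun j => inferInstanceAs (Mono ((e j).hom ≫ (T j).f))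
  obtain ⟨f, hf⟩ := exists_hom_homologyMap_eq P I hI hinj m
  let φ : P ⟶ I ⊞ D := biprod.lift f (homotopyCofiber.inr (𝟙 P))
  have hφ : ∀ j, φ.f j ≫ (biprod.snd : I ⊞ D ⟶ D).f j ≫ homotopyCofiber.sndX (𝟙 P) j =
      𝟙 (P.X j) := fun j => by simp [φ, D]
  have : ∀ j, Mono (φ.f j) := fun j => by
    have := hφ j
    exact (SplitMono.mk _ this).mono
  have : Mono φ := mono_of_mono_f φ inferInstance
  let S : ShortComplex (ChainComplex A ℤ) := ShortComplex.mk φ (cokernel.π φ) (by simp)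
  have hS : S.ShortExact :=
    { exact := ShortComplex.exact_cokernel φ
      mono_f := inferInstanceAs (Mono φ)
      epi_g := inferInstanceAs (Epi (cokernel.π φ)) }
  let a : ∀ j, (I ⊞ D).homology j ⟶ I.X j := fun j =>
    homologyMap biprod.fst j ≫ (homologyIsoX I hI j).hom
  have ha : ∀ j, IsIso (a j) := fun j => by
    have := isIso_homologyMap_biprod_fst I D j (isZero_homology_homotopyCofiber_id P j)
    exact IsIso.comp_isIso
  have hφa : ∀ j, homologyMap φ j ≫ a j = m j := fun j => by
    rw [← hf j, ← homologyMap_comp_assoc, biprod.lift_fst]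
  have hφmono : ∀ j, Mono (homologyMap φ j) := fun j => by
    have : Mono (homologyMap φ j ≫ a j) := by rw [hφa]; exact hm j
    exact mono_of_mono _ (a j)
  have hSX : ∀ j, (S.map (eval A (ComplexShape.down ℤ) j)).ShortExact := fun j =>
    hS.map_of_exact _
  refine ⟨S.X₃, fun j => ?_, fun j => ⟨?_⟩, fun j h₁ h₂ h₃ => ?_⟩
  · have hepi := (hSX j).epi_g
    have : Projective (P.X j) := hP j
    have : Projective (P.X (j - 1)) := hP (j - 1)
    have : Projective (D.X j) := Projective.of_iso
      (homotopyCofiber.XIsoBiprod (𝟙 P) j (j - 1) (by simp)).symm inferInstance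
    have : Projective (I.X j) := hproj j
    have : Projective ((I ⊞ D).X j) := Projective.of_iso (biprodXIso I D j).symm inferInstance
    let σ := ShortComplex.Splitting.ofExactOfRetraction _ (hSX j).exact
      ((biprod.snd : I ⊞ D ⟶ D).f j ≫ homotopyCofiber.sndX (𝟙 P) j) (hφ j) hepi
    exact Retract.projective (Y := (I ⊞ D).X j) ⟨σ.s, (cokernel.π φ).f j, σ.s_g⟩
  · have hH := shortExact_homology S hS hφmono j
    have := hH.epi_g
    exact IsColimit.coconePointsIsoOfNatIso hH.exact.gIsCokernel (hT j).exact.gIsCokernel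
      (parallelPair.ext (e j) (@asIso _ _ _ _ (a j) (ha j)) (hφa j) (by simp))
  · have hepi := (hSX j).epi_g
    have hD : IsZero (D.X j) := IsZero.of_iso
      ((biprod_isZero_iff _ _).2 ⟨h₂, h₁⟩)
      (homotopyCofiber.XIsoBiprod (𝟙 P) j (j - 1) (by simp))
    have hY : IsZero ((I ⊞ D).X j) :=
      IsZero.of_iso ((biprod_isZero_iff _ _).2 ⟨h₃, hD⟩) (biprodXIso I D j)
    exact @IsZero.of_epi _ _ _ _ _ (S.map (eval A (ComplexShape.down ℤ) j)).g hepi hY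

/-- The short complex obtained by taking `n` copies of each term. -/
noncomputable def copiesShortComplex (S : ShortComplex A) (n : ℕ) : ShortComplex A where
  X₁ := copies S.X₁ n
  X₂ := copies S.X₂ n
  X₃ := copies S.X₃ n
  f := biproduct.map fun _ => S.f
  g := biproduct.map fun _ => S.g
  zero := by
    apply biproduct.hom_ext'
    intro i
    change biproduct.ι (fun _ : Fin n => S.X₁) i ≫ biproduct.map _ ≫ biproduct.map _ = _ ≫ 0
    simp

lemma shortExact_copiesShortComplex (S : ShortComplex A) (hS : S.ShortExact) (n : ℕ) :
    (copiesShortComplex S n).ShortExact := by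
  have := hS.mono_f
  have := hS.epi_g
  have hepi : Epi (copiesShortComplex S n).g :=
    inferInstanceAs (Epi (biproduct.map fun _ : Fin n => S.g))
  refine
    { exact := ShortComplex.exact_of_g_is_cokernel _
        (CokernelCofork.IsColimit.ofπ' _ _ fun {W} k hk => ?_)
      mono_f := inferInstanceAs (Mono (biproduct.map fun _ : Fin n => S.f))
      epi_g := hepi }
  change (⨁ fun _ : Fin n => S.X₂) ⟶ W at k
  have hk' : biproduct.map (fun _ : Fin n => S.f) ≫ k = 0 := hk
  have hι : ∀ i : Fin n, S.f ≫ biproduct.ι (fun _ : Fin n => S.X₂) i ≫ k = 0 := fun i => by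
    rw [← biproduct.ι_map_assoc (fun _ : Fin n => S.f), hk', comp_zero]
  refine ⟨biproduct.desc fun i => hS.exact.desc _ (hι i), ?_⟩
  change biproduct.map (fun _ : Fin n => S.g) ≫ _ = k
  ext i
  simp

lemma projective_copies (M : A) [Projective M] (n : ℕ) : Projective (copies M n) := by
  refine ⟨fun {_ X} f e _ => ?_⟩
  change (⨁ fun _ : Fin n => M) ⟶ X at f
  refine ⟨biproduct.desc fun i => Projective.factorThru
    (biproduct.ι (fun _ : Fin n => M) i ≫ f) e, ?_⟩
  change biproduct.desc _ ≫ e = f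
  ext i
  simp

lemma isZero_copies_zero (M : A) : IsZero (copies M 0) := by
  rw [IsZero.iff_id_eq_zero]
  apply biproduct.hom_ext
  exact fun i => i.elim0

lemma isZero_copies_iff {M : A} (hM : ¬ IsZero M) (n : ℕ) : IsZero (copies M n) ↔ n = 0 := by
  refine ⟨fun h => ?_, ?_⟩
  · by_contra hn
    exact hM (IsZero.of_mono (biproduct.ι (fun _ : Fin n => M) ⟨0, Nat.pos_of_ne_zero hn⟩) h)
  · rintro rfl
    exact isZero_copies_zero M

/-- A finite quasi-projective resolution bounds the quasi-projective dimension. -/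
lemma qpd_le_of_isFiniteQuasiProjRes {M : A} {P : ChainComplex A ℤ}
    (hP : IsFiniteQuasiProjRes M P) {b t : ℤ} (ht : IsHSup P t)
    (hb : ∀ i, b < i → IsZero (P.X i)) : qpd M ≤ ((b - t).toNat : ℕ∞) := by
  unfold qpd
  split_ifs
  · simp
  have hPt : ¬ IsZero (P.X t) := fun h =>
    ht.1 ((P.exactAt_iff_isZero_homology t).1 (ShortComplex.exact_of_isZero_X₂ _ h))
  obtain ⟨s, hs, hs'⟩ := Int.exists_greatest_of_bdd (P := fun i => ¬ IsZero (P.X i))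
    ⟨b, fun i hi => not_lt.1 fun hbi => hi (hb i hbi)⟩ ⟨t, hPt⟩
  have hsb : s ≤ b := not_lt.1 fun h => hs (hb s h)
  have hsup : IsSup P s := ⟨hs, fun i hi => by_contra fun h => absurd (hs' i h) (not_le.2 hi)⟩
  refine le_trans (b := ((s - t).toNat : ℕ∞)) (sInf_le ⟨P, s, t, hP, hsup, ht, rfl⟩) ?_
  exact_mod_cast Int.toNat_le_toNat (by lia)

/-- A projective object has quasi-projective dimension zero. -/
lemma qpd_eq_zero_of_projective (M : A) [Projective M] : qpd M = 0 := by
  by_cases hM : IsZero M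
  · simp [qpd, hM]
  let P : ChainComplex A ℤ := (single A (ComplexShape.down ℤ) 0).obj M
  have hX : ∀ i, i ≠ 0 → IsZero (P.X i) := fun i hi => isZero_single_obj_X _ _ _ _ hi
  have hH : ∀ i, i ≠ 0 → IsZero (P.homology i) := fun i hi =>
    isZero_single_obj_homology _ _ _ _ hi
  have hP : IsFiniteQuasiProjRes M P :=
    { projective := fun i => by
        by_cases hi : i = 0
        · subst hi
          exact Projective.of_iso (singleObjXSelf _ 0 M).symm inferInstance
        · exact (hX i hi).projective
      bddBelow := ⟨0, fun i hi => hX i hi.ne⟩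
      bddAbove := ⟨0, fun i hi => hX i hi.ne'⟩
      homology_iso := ⟨fun j => if j = 0 then 1 else 0, ⟨0, by simp⟩, fun j => by
        by_cases hj : j = 0
        · subst hj
          exact ⟨singleObjHomologySelfIso _ 0 M ≪≫
            (biproductUniqueIso (fun _ : Fin 1 => M)).symm⟩
        · simp only [hj, if_false]
          exact ⟨(hH j hj).iso (isZero_copies_zero M)⟩⟩ }
  have ht : IsHSup P 0 :=
    ⟨fun h => hM (h.of_iso (singleObjHomologySelfIso _ 0 M).symm), fun i hi => hH i hi.ne'⟩
  have := qpd_le_of_isFiniteQuasiProjRes hP (b := 0) ht fun i hi => hX i hi.ne'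
  simpa using this

end QPD

end

open QPD in
/-- If `0 → N → E → M → 0` is exact with `E` projective-injective,
then `qpd M ≤ qpd N + 1`. -/
theorem qpd_le_qpd_add_one_of_shortExact {A : Type*} [Category A] [Abelian A]
    [EnoughProjectives A] (S : ShortComplex A) (hS : S.ShortExact)
    (hproj : Projective S.X₂) (hinj : Injective S.X₂) :
    qpd S.X₃ ≤ qpd S.X₁ + 1 := by
  by_cases hM : IsZero S.X₃
  · simp [qpd, hM]
  by_cases hN : IsZero S.X₁
  · have := hS.epi_g
    have : Mono S.g := (ShortComplex.exact_iff_mono _ (hN.eq_of_src S.f 0)).1 hS.exact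
    have : IsIso S.g := isIso_of_mono_of_epi _
    have : Projective S.X₃ := Projective.of_iso (asIso S.g) hproj
    simp [qpd_eq_zero_of_projective S.X₃]
  rw [show qpd S.X₁ = _ from if_neg hN]
  rw [ENat.sInf_add]
  refine le_iInf₂ ?_
  rintro _ ⟨P, s, t, hP, hs, ht, rfl⟩
  obtain ⟨mult, -, hmult⟩ := hP.homology_iso
  have hzero : ∀ j, IsZero (P.homology j) ↔ mult j = 0 := fun j =>
    (hmult j).some.isZero_iff.trans (isZero_copies_iff hN _)
  have hmultX : ∀ j, IsZero (P.X j) → mult j = 0 := fun j h =>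
    (hzero j).1 ((P.exactAt_iff_isZero_homology j).1 (ShortComplex.exact_of_isZero_X₂ _ h))
  obtain ⟨Q, hQproj, hQH, hQ⟩ := exists_complex_homology_iso P hP.projective
    (fun j => copiesShortComplex S (mult j)) (fun j => shortExact_copiesShortComplex S hS _)
    (fun j => (hmult j).some)
    (fun j => projective_copies _ _)
    (fun j => inferInstanceAs (Injective (⨁ fun _ : Fin (mult j) => S.X₂)))
  have hQH' : ∀ j, IsZero (Q.homology j) ↔ mult j = 0 := fun j =>
    (hQH j).some.isZero_iff.trans (isZero_copies_iff hM _)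
  have hQ' : ∀ j, IsZero (P.X j) → IsZero (P.X (j - 1)) → IsZero (Q.X j) := fun j h₁ h₂ =>
    hQ j h₁ h₂ (by
      change IsZero (copies S.X₂ (mult j))
      rw [hmultX j h₁]
      exact isZero_copies_zero _)
  obtain ⟨a, ha⟩ := hP.bddBelow
  have hb : ∀ i, s + 1 < i → IsZero (Q.X i) := fun i hi =>
    hQ' i (hs.2 i (by lia)) (hs.2 _ (by lia))
  have hQt : IsHSup Q t :=
    ⟨fun h => ht.1 ((hzero t).2 ((hQH' t).1 h)),
      fun i hi => (hQH' i).2 ((hzero i).1 (ht.2 i hi))⟩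
  have hQres : IsFiniteQuasiProjRes S.X₃ Q :=
    { projective := hQproj
      bddBelow := ⟨a, fun i hi => hQ' i (ha i hi) (ha _ (by lia))⟩
      bddAbove := ⟨s + 1, hb⟩
      homology_iso := ⟨mult, ⟨t, fun h => ht.1 ((hzero t).2 h)⟩, hQH⟩ }
  refine (qpd_le_of_isFiniteQuasiProjRes hQres hQt hb).trans ?_
  exact_mod_cast (by lia : (s + 1 - t).toNat ≤ (s - t).toNat + 1)
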